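/- arXiv:2209.03082 — 10 statements merged into one kernel-verified Lean document; each statement's English description precedes it below -/
import Mathlib

section
/- Let d > 0, a > 0 and x_t, y_t, x_n, y_n ∈ ℝ. Define the pairs X = (a/2 + x_n − x_t, a/2 − x_n + x_t) and Y = (a/2 + y_n − y_t, a/2 − y_n + y_t). Then the double integral (1/(4π)) ∫_{y_n−a/2}^{y_n+a/2} ∫_{x_n−a/2}^{x_n+a/2} [d·((x−x_t)² + d²)] / [((x−x_t)² + (y−y_t)² + d²)^{5/2}] dx dy equals ζ := (1/(4π)) Σ_{x ∈ X} Σ_{y ∈ Y} [ (xy/d²) / (3(y²/d² + 1)·√(x²/d² + y²/d² + 1)) + (2/3)·arctan( (xy/d²) / √(x²/d² + y²/d² + 1) ) ], where the double sum runs over both components of each pair (four terms in total). -/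
open Real MeasureTheory

/-- One of the four closed-form terms in the channel-gain expression. -/
noncomputable def zetaTerm (d x y : ℝ) : ℝ :=
  (x * y / d ^ 2) / (3 * (y ^ 2 / d ^ 2 + 1) * Real.sqrt (x ^ 2 / d ^ 2 + y ^ 2 / d ^ 2 + 1))
  + (2 / 3) * Real.arctan ((x * y / d ^ 2) / Real.sqrt (x ^ 2 / d ^ 2 + y ^ 2 / d ^ 2 + 1))

/-- The closed-form channel gain ζ for a square antenna of side `a` centered at
`(xn, yn, 0)` and a transmitter at `(xt, yt, d)`: the sum runs over the pairs
`X = (a/2 + xn − xt, a/2 − xn + xt)` and `Y = (a/2 + yn − yt, a/2 − yn + yt)`. -/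
noncomputable def zetaClosed (d a xt yt xn yn : ℝ) : ℝ :=
  (1 / (4 * Real.pi)) *
    (zetaTerm d (a / 2 + xn - xt) (a / 2 + yn - yt)
     + zetaTerm d (a / 2 + xn - xt) (a / 2 - yn + yt)
     + zetaTerm d (a / 2 - xn + xt) (a / 2 + yn - yt)
     + zetaTerm d (a / 2 - xn + xt) (a / 2 - yn + yt))

theorem zetaTerm_eq_sqrt (d x y : ℝ) (hd : 0 < d) :
    zetaTerm d x y = d * x * y / (3 * (y ^ 2 + d ^ 2) * √(x ^ 2 + y ^ 2 + d ^ 2))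
      + (2 / 3) * arctan (x * y / (d * √(x ^ 2 + y ^ 2 + d ^ 2))) := by
  have hS : √(x ^ 2 / d ^ 2 + y ^ 2 / d ^ 2 + 1) = √(x ^ 2 + y ^ 2 + d ^ 2) / d := by
    rw [show x ^ 2 / d ^ 2 + y ^ 2 / d ^ 2 + 1 = (x ^ 2 + y ^ 2 + d ^ 2) / d ^ 2 by field_simp,
      Real.sqrt_div' _ (by positivity), Real.sqrt_sq hd.le]
  have hpos : 0 < √(x ^ 2 + y ^ 2 + d ^ 2) := by positivity
  unfold zetaTerm
  rw [hS]
  congr 1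
  · field_simp
  · congr 2
    field_simp

theorem zetaTerm_neg_left (d x y : ℝ) : zetaTerm d (-x) y = -zetaTerm d x y := by
  simp only [zetaTerm, neg_mul, neg_sq, neg_div, arctan_neg]
  ring

theorem zetaTerm_neg_right (d x y : ℝ) : zetaTerm d x (-y) = -zetaTerm d x y := by
  simp only [zetaTerm, mul_neg, neg_sq, neg_div, arctan_neg]
  ring

/-- The partial derivative of `zetaTerm d x y` with respect to `y`. -/
noncomputable def zetaTermDeriv (d x y : ℝ) : ℝ :=
  d * x * (d ^ 2 - y ^ 2) / (3 * (y ^ 2 + d ^ 2) ^ 2 * √(x ^ 2 + y ^ 2 + d ^ 2))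
    - d * x * y ^ 2 / (3 * (y ^ 2 + d ^ 2) * √(x ^ 2 + y ^ 2 + d ^ 2) ^ 3)
    + 2 * d * x / (3 * (y ^ 2 + d ^ 2) * √(x ^ 2 + y ^ 2 + d ^ 2))

theorem hasDerivAt_zetaTerm (d x y : ℝ) (hd : 0 < d) :
    HasDerivAt (fun y => zetaTerm d x y) (zetaTermDeriv d x y) y := by
  have hq : 0 < x ^ 2 + y ^ 2 + d ^ 2 := by positivity
  have hpos : 0 < √(x ^ 2 + y ^ 2 + d ^ 2) := by positivity
  have hsq : √(x ^ 2 + y ^ 2 + d ^ 2) ^ 2 = x ^ 2 + y ^ 2 + d ^ 2 := Real.sq_sqrt hq.le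
  have hsqy : HasDerivAt (fun y : ℝ => y ^ 2) (2 * y) y := by
    simpa using hasDerivAt_pow 2 y
  have hS : HasDerivAt (fun y => √(x ^ 2 + y ^ 2 + d ^ 2)) (y / √(x ^ 2 + y ^ 2 + d ^ 2)) y := by
    convert ((hsqy.const_add (x ^ 2)).add_const (d ^ 2)).sqrt hq.ne' using 1
    field_simp
  have hA := ((hasDerivAt_id' y).const_mul (d * x)).fun_div
    (((hsqy.add_const (d ^ 2)).const_mul 3).fun_mul hS) (by positivity)
  have hB := (((hasDerivAt_id' y).const_mul x).fun_div (hS.const_mul d)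
    (by positivity)).arctan.const_mul (2 / 3)
  have hT : (fun y => zetaTerm d x y) = _ := funext fun y => zetaTerm_eq_sqrt d x y hd
  rw [hT]
  refine (hA.fun_add hB).congr_deriv ?_
  unfold zetaTermDeriv
  generalize √(x ^ 2 + y ^ 2 + d ^ 2) = S at hpos hsq ⊢
  have hB' : 1 / (1 + (x * y / (d * S)) ^ 2) =
      d ^ 2 * S ^ 2 / ((x ^ 2 + d ^ 2) * (y ^ 2 + d ^ 2)) := by
    rw [div_eq_div_iff (by positivity) (by positivity)]
    field_simp
    rw [hsq]
    ring
  rw [hB']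
  have hB'' : 2 / 3 * (d ^ 2 * S ^ 2 / ((x ^ 2 + d ^ 2) * (y ^ 2 + d ^ 2)) *
      ((x * 1 * (d * S) - x * y * (d * (y / S))) / (d * S) ^ 2))
      = 2 * d * x / (3 * (y ^ 2 + d ^ 2) * S) := by
    field_simp
    rw [hsq]
    ring
  rw [hB'']
  congr 1
  field_simp
  ring

theorem hasDerivAt_zetaTermDeriv (d x y : ℝ) (hd : 0 < d) :
    HasDerivAt (fun x => zetaTermDeriv d x y)
      (d * (x ^ 2 + d ^ 2) / (x ^ 2 + y ^ 2 + d ^ 2) ^ ((5 : ℝ) / 2)) x := by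
  have hq : 0 < x ^ 2 + y ^ 2 + d ^ 2 := by positivity
  have hpos : 0 < √(x ^ 2 + y ^ 2 + d ^ 2) := by positivity
  have hsq : √(x ^ 2 + y ^ 2 + d ^ 2) ^ 2 = x ^ 2 + y ^ 2 + d ^ 2 := Real.sq_sqrt hq.le
  have hsqx : HasDerivAt (fun x : ℝ => x ^ 2) (2 * x) x := by
    simpa using hasDerivAt_pow 2 x
  have hS : HasDerivAt (fun x => √(x ^ 2 + y ^ 2 + d ^ 2)) (x / √(x ^ 2 + y ^ 2 + d ^ 2)) x := by
    convert ((hsqx.add_const (y ^ 2)).add_const (d ^ 2)).sqrt hq.ne' using 1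
    field_simp
  have hrpow : (x ^ 2 + y ^ 2 + d ^ 2) ^ ((5 : ℝ) / 2) = √(x ^ 2 + y ^ 2 + d ^ 2) ^ 5 := by
    rw [Real.sqrt_eq_rpow, ← Real.rpow_mul_natCast hq.le]
    norm_num
  have hlin := (hasDerivAt_id' x).const_mul d
  have hA := (hlin.mul_const (d ^ 2 - y ^ 2)).fun_div
    (hS.const_mul (3 * (y ^ 2 + d ^ 2) ^ 2)) (by positivity)
  have hB := (hlin.mul_const (y ^ 2)).fun_div
    ((hS.fun_pow 3).const_mul (3 * (y ^ 2 + d ^ 2))) (by positivity)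
  have hC := ((hasDerivAt_id' x).const_mul (2 * d)).fun_div
    (hS.const_mul (3 * (y ^ 2 + d ^ 2))) (by positivity)
  unfold zetaTermDeriv
  refine ((hA.fun_sub hB).fun_add hC).congr_deriv ?_
  rw [hrpow]
  generalize √(x ^ 2 + y ^ 2 + d ^ 2) = S at hpos hsq ⊢
  have hx : x ^ 2 = S ^ 2 - y ^ 2 - d ^ 2 := by linarith
  field_simp
  simp only [hx]
  push_cast
  ring

theorem continuous_zetaTermDeriv (d x : ℝ) (hd : 0 < d) :
    Continuous (fun y => zetaTermDeriv d x y) := by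
  have h₁ (y : ℝ) : 3 * (y ^ 2 + d ^ 2) ^ 2 * √(x ^ 2 + y ^ 2 + d ^ 2) ≠ 0 := by positivity
  have h₂ (y : ℝ) : 3 * (y ^ 2 + d ^ 2) * √(x ^ 2 + y ^ 2 + d ^ 2) ^ 3 ≠ 0 := by positivity
  have h₃ (y : ℝ) : 3 * (y ^ 2 + d ^ 2) * √(x ^ 2 + y ^ 2 + d ^ 2) ≠ 0 := by positivity
  unfold zetaTermDeriv
  fun_prop (disch := assumption)

theorem integral_zetaTermDeriv (d x y₁ y₂ : ℝ) (hd : 0 < d) :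
    ∫ y in y₁..y₂, zetaTermDeriv d x y = zetaTerm d x y₂ - zetaTerm d x y₁ := by
  refine intervalIntegral.integral_eq_sub_of_hasDerivAt
    (fun y _ => hasDerivAt_zetaTerm d x y hd) ?_
  exact (continuous_zetaTermDeriv d x hd).intervalIntegrable _ _

theorem integral_div_rpow_eq_zetaTermDeriv_sub (d y x₁ x₂ : ℝ) (hd : 0 < d) :
    ∫ x in x₁..x₂, d * (x ^ 2 + d ^ 2) / (x ^ 2 + y ^ 2 + d ^ 2) ^ ((5 : ℝ) / 2)
      = zetaTermDeriv d x₂ y - zetaTermDeriv d x₁ y := by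
  refine intervalIntegral.integral_eq_sub_of_hasDerivAt
    (fun x _ => hasDerivAt_zetaTermDeriv d x y hd) ?_
  refine Continuous.intervalIntegrable ?_ _ _
  refine Continuous.div (by fun_prop) ?_ fun x => by positivity
  exact Continuous.rpow_const (by fun_prop) fun x => Or.inl (by positivity)

theorem channel_gain_integral_closed_form
    (d a xt yt xn yn : ℝ) (hd : 0 < d) (ha : 0 < a) :
    (1 / (4 * Real.pi)) *
      ∫ y in (yn - a / 2)..(yn + a / 2), ∫ x in (xn - a / 2)..(xn + a / 2),
        (d * ((x - xt) ^ 2 + d ^ 2)) /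
          (((x - xt) ^ 2 + (y - yt) ^ 2 + d ^ 2) ^ ((5 : ℝ) / 2))
    = zetaClosed d a xt yt xn yn := by
  have hinner (y : ℝ) :
      ∫ x in (xn - a / 2)..(xn + a / 2), (d * ((x - xt) ^ 2 + d ^ 2)) /
          (((x - xt) ^ 2 + (y - yt) ^ 2 + d ^ 2) ^ ((5 : ℝ) / 2))
        = zetaTermDeriv d (xn + a / 2 - xt) (y - yt)
          - zetaTermDeriv d (xn - a / 2 - xt) (y - yt) := by
    rw [← integral_div_rpow_eq_zetaTermDeriv_sub d (y - yt) _ _ hd]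
    exact intervalIntegral.integral_comp_sub_right
      (fun x => d * (x ^ 2 + d ^ 2) / (x ^ 2 + (y - yt) ^ 2 + d ^ 2) ^ ((5 : ℝ) / 2)) xt
  simp only [hinner]
  rw [intervalIntegral.integral_comp_sub_right
      (fun y => zetaTermDeriv d (xn + a / 2 - xt) y - zetaTermDeriv d (xn - a / 2 - xt) y) yt,
    intervalIntegral.integral_sub
      ((continuous_zetaTermDeriv d _ hd).intervalIntegrable _ _)
      ((continuous_zetaTermDeriv d _ hd).intervalIntegrable _ _),
    integral_zetaTermDeriv d _ _ _ hd, integral_zetaTermDeriv d _ _ _ hd]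
  rw [show xn + a / 2 - xt = a / 2 + xn - xt by ring,
    show xn - a / 2 - xt = -(a / 2 - xn + xt) by ring,
    show yn + a / 2 - yt = a / 2 + yn - yt by ring,
    show yn - a / 2 - yt = -(a / 2 - yn + yt) by ring]
  simp only [zetaTerm_neg_left, zetaTerm_neg_right, zetaClosed]
  ring
end

section
/- Let d > 0, A > 0 and N ≥ 1 be a natural number, and set β_d = A/(4πd²). Then (1/(4π)) ∫_{−√(NA)/2}^{√(NA)/2} ∫_{−√(NA)/2}^{√(NA)/2} [d·(x² + d²)] / [(x² + y² + d²)^{5/2}] dx dy = α_{d,N}, where α_{d,N} := Nβ_d / (3(Nβ_d·π + 1)·√(2Nβ_d·π + 1)) + (2/(3π))·arctan( Nβ_d·π / √(2Nβ_d·π + 1) ). -/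
open Real MeasureTheory

/-- The total channel gain `α_{d,N}` of a centered planar square array of total area `N·A`
at distance `d`, with single-antenna gain `β_d = A/(4πd²)`. -/
noncomputable def alphaGain (d A : ℝ) (N : ℕ) : ℝ :=
  (N * (A / (4 * Real.pi * d ^ 2))) /
      (3 * (N * (A / (4 * Real.pi * d ^ 2)) * Real.pi + 1) *
        Real.sqrt (2 * N * (A / (4 * Real.pi * d ^ 2)) * Real.pi + 1))
    + (2 / (3 * Real.pi)) *
      Real.arctan ((N * (A / (4 * Real.pi * d ^ 2)) * Real.pi) /
        Real.sqrt (2 * N * (A / (4 * Real.pi * d ^ 2)) * Real.pi + 1))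

lemma hasDerivAt_sqrt_sq_add {c : ℝ} (hc : 0 < c) (x : ℝ) :
    HasDerivAt (fun x => √(x ^ 2 + c)) (x / √(x ^ 2 + c)) x := by
  have h := (((hasDerivAt_id x).pow 2).add_const c).sqrt (by simp; positivity)
  simp only [id, Pi.pow_apply] at h
  convert h using 1
  field_simp
  push_cast
  ring

lemma rpow_five_halves {s : ℝ} (hs : 0 < s) : s ^ ((5 : ℝ) / 2) = √s ^ 5 := by
  rw [Real.sqrt_eq_rpow, ← Real.rpow_mul_natCast hs.le]
  norm_num

/-- The integral of `(y² + c)^(-5/2)` over a symmetric interval. -/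
lemma integral_inv_sqrt_sq_add_pow_five {c : ℝ} (hc : 0 < c) (a : ℝ) :
    ∫ y in -a..a, 1 / √(y ^ 2 + c) ^ 5 =
      2 * a / (3 * c * √(a ^ 2 + c) ^ 3) + 4 * a / (3 * c ^ 2 * √(a ^ 2 + c)) := by
  have hpos (y : ℝ) : 0 < √(y ^ 2 + c) := by positivity
  rw [intervalIntegral.integral_eq_sub_of_hasDerivAt
    (f := fun y => y / (3 * c * √(y ^ 2 + c) ^ 3) + 2 * y / (3 * c ^ 2 * √(y ^ 2 + c)))]
  · have := hpos a
    rw [neg_sq]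
    field_simp
    ring
  · intro y _
    have hr := hpos y
    have hsq : √(y ^ 2 + c) ^ 2 = y ^ 2 + c := Real.sq_sqrt (by positivity)
    have h1 := (hasDerivAt_id' y).fun_div
      (((hasDerivAt_sqrt_sq_add hc y).fun_pow 3).const_mul (3 * c)) (by positivity)
    have h2 := ((hasDerivAt_id' y).const_mul 2).fun_div
      ((hasDerivAt_sqrt_sq_add hc y).const_mul (3 * c ^ 2)) (by positivity)
    refine (h1.fun_add h2).congr_deriv ?_
    clear h1 h2 hpos
    generalize √(y ^ 2 + c) = r at *
    obtain rfl : c = r ^ 2 - y ^ 2 := by linarith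
    have := hc.ne'
    push_cast
    field_simp
    ring
  · refine (Continuous.div (by fun_prop) (by fun_prop) fun y => ?_).intervalIntegrable _ _
    exact (pow_pos (hpos y) 5).ne'

/-- The remaining one-dimensional integral of the channel gain. -/
lemma integral_channel_gain_slice {a d : ℝ} (ha : 0 < a) (hd : 0 < d) :
    ∫ x in -a..a, (2 * d * a / (3 * √(x ^ 2 + (a ^ 2 + d ^ 2)) ^ 3) +
        4 * d * a / (3 * (x ^ 2 + d ^ 2) * √(x ^ 2 + (a ^ 2 + d ^ 2)))) =
      4 * d * a ^ 2 / (3 * (a ^ 2 + d ^ 2) * √(a ^ 2 + (a ^ 2 + d ^ 2))) +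
        8 / 3 * arctan (a ^ 2 / (d * √(a ^ 2 + (a ^ 2 + d ^ 2)))) := by
  have hc : 0 < a ^ 2 + d ^ 2 := by positivity
  have hpos (x : ℝ) : 0 < √(x ^ 2 + (a ^ 2 + d ^ 2)) := by positivity
  rw [intervalIntegral.integral_eq_sub_of_hasDerivAt
    (f := fun x => 2 * d * a * x / (3 * (a ^ 2 + d ^ 2) * √(x ^ 2 + (a ^ 2 + d ^ 2))) +
      4 / 3 * arctan (a * x / (d * √(x ^ 2 + (a ^ 2 + d ^ 2)))))]
  · rw [neg_sq, mul_neg a a, neg_div, arctan_neg, ← sq]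
    ring
  · intro x _
    have hr := hpos x
    have hsq : √(x ^ 2 + (a ^ 2 + d ^ 2)) ^ 2 = x ^ 2 + (a ^ 2 + d ^ 2) :=
      Real.sq_sqrt (by positivity)
    have h1 := ((hasDerivAt_id' x).const_mul (2 * d * a)).fun_div
      ((hasDerivAt_sqrt_sq_add hc x).const_mul (3 * (a ^ 2 + d ^ 2))) (by positivity)
    have h2 := (((hasDerivAt_id' x).const_mul a).fun_div
      ((hasDerivAt_sqrt_sq_add hc x).const_mul d) (by positivity)).arctan.const_mul (4 / 3)
    refine (h1.fun_add h2).congr_deriv ?_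
    clear h1 h2 hpos
    generalize √(x ^ 2 + (a ^ 2 + d ^ 2)) = r at *
    have e1 : 1 + (a * x / (d * r)) ^ 2 =
        (a ^ 2 + d ^ 2) * (x ^ 2 + d ^ 2) / (d * r) ^ 2 := by
      field_simp
      rw [hsq]
      ring
    have e2 : (2 * d * a * 1 * (3 * (a ^ 2 + d ^ 2) * r) -
        2 * d * a * x * (3 * (a ^ 2 + d ^ 2) * (x / r))) / (3 * (a ^ 2 + d ^ 2) * r) ^ 2 =
        2 * d * a / (3 * r ^ 3) := by
      field_simp
      rw [hsq]
      ring
    have e3 : (a * 1 * (d * r) - a * x * (d * (x / r))) / (d * r) ^ 2 =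
        a * (a ^ 2 + d ^ 2) / (d * r ^ 3) := by
      field_simp
      rw [hsq]
      ring
    rw [e1, e2, e3]
    field_simp
  · refine (Continuous.add (Continuous.div (by fun_prop) (by fun_prop) fun x => ?_)
      (Continuous.div (by fun_prop) (by fun_prop) fun x => ?_)).intervalIntegrable _ _
    · have := hpos x
      positivity
    · have := hpos x
      positivity

lemma integral_integral_channel_gain {a d : ℝ} (ha : 0 < a) (hd : 0 < d) :
    ∫ y in -a..a, ∫ x in -a..a,
        (d * (x ^ 2 + d ^ 2)) / ((x ^ 2 + y ^ 2 + d ^ 2) ^ ((5 : ℝ) / 2)) =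
      4 * d * a ^ 2 / (3 * (a ^ 2 + d ^ 2) * √(a ^ 2 + (a ^ 2 + d ^ 2))) +
        8 / 3 * arctan (a ^ 2 / (d * √(a ^ 2 + (a ^ 2 + d ^ 2)))) := by
  rw [intervalIntegral_intervalIntegral_swap, ← integral_channel_gain_slice ha hd]
  · congr 1 with x
    have hc : 0 < x ^ 2 + d ^ 2 := by positivity
    have hcongr (y : ℝ) : d * (x ^ 2 + d ^ 2) / (x ^ 2 + y ^ 2 + d ^ 2) ^ ((5 : ℝ) / 2) =
        d * (x ^ 2 + d ^ 2) * (1 / √(y ^ 2 + (x ^ 2 + d ^ 2)) ^ 5) := by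
      rw [rpow_five_halves (by positivity), mul_one_div]
      ring_nf
    simp_rw [hcongr]
    rw [intervalIntegral.integral_const_mul, integral_inv_sqrt_sq_add_pow_five hc,
      show a ^ 2 + (x ^ 2 + d ^ 2) = x ^ 2 + (a ^ 2 + d ^ 2) by ring]
    have : 0 < √(x ^ 2 + (a ^ 2 + d ^ 2)) := by positivity
    field_simp
  · refine (Continuous.continuousOn ?_).integrableOn_compact
      (isCompact_uIcc.prod isCompact_uIcc) |>.mono_set
      (Set.prod_mono Set.uIoc_subset_uIcc Set.uIoc_subset_uIcc)
    refine Continuous.div (by fun_prop) (Continuous.rpow_const (by fun_prop) fun p => ?_)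
      fun p => ?_
    · right; norm_num
    · positivity

theorem centered_array_channel_gain
    (d A : ℝ) (N : ℕ) (hd : 0 < d) (hA : 0 < A) (hN : 1 ≤ N) :
    (1 / (4 * Real.pi)) *
      ∫ y in (-(Real.sqrt (N * A)) / 2)..(Real.sqrt (N * A) / 2),
        ∫ x in (-(Real.sqrt (N * A)) / 2)..(Real.sqrt (N * A) / 2),
          (d * (x ^ 2 + d ^ 2)) / ((x ^ 2 + y ^ 2 + d ^ 2) ^ ((5 : ℝ) / 2))
    = alphaGain d A N := by
  have hN' : (0 : ℝ) < N := by exact_mod_cast hN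
  obtain ⟨a, ha, hadef⟩ : ∃ a : ℝ, 0 < a ∧ √(N * A) / 2 = a := ⟨_, by positivity, rfl⟩
  have hNA : N * A = 4 * a ^ 2 := by
    rw [← hadef, div_pow, Real.sq_sqrt (by positivity)]
    ring
  have hpi := Real.pi_pos
  have hβ : N * (A / (4 * π * d ^ 2)) = a ^ 2 / (π * d ^ 2) := by
    rw [← mul_div_assoc, hNA]
    field_simp
  have hsqrt : √(2 * (a ^ 2 / (π * d ^ 2)) * π + 1) = √(a ^ 2 + (a ^ 2 + d ^ 2)) / d := by
    rw [show 2 * (a ^ 2 / (π * d ^ 2)) * π + 1 = (a ^ 2 + (a ^ 2 + d ^ 2)) / d ^ 2 by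
      field_simp; ring, Real.sqrt_div (by positivity), Real.sqrt_sq hd.le]
  have hr : 0 < √(a ^ 2 + (a ^ 2 + d ^ 2)) := by positivity
  rw [neg_div, hadef, integral_integral_channel_gain ha hd, alphaGain, mul_assoc 2 (N : ℝ), hβ,
    hsqrt]
  have harg : a ^ 2 / (π * d ^ 2) * π / (√(a ^ 2 + (a ^ 2 + d ^ 2)) / d) =
      a ^ 2 / (d * √(a ^ 2 + (a ^ 2 + d ^ 2))) := by
    field_simp
  rw [harg]
  field_simp
  ring
end

section
/- Define g(t) = t / (3(tπ + 1)·√(2tπ + 1)) + (2/(3π))·arctan( tπ / √(2tπ + 1) ) for t > 0. Then g(t) → 1/3 as t → +∞. In particular, for any fixed d > 0 and A > 0, the total channel gain α_{d,N} = g(Nβ_d) with β_d = A/(4πd²) converges to 1/3 as N → ∞. -/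
open Real Filter Topology

/-- The total channel gain of a centered planar array, as a function of `t = N·β_d`. -/
noncomputable def gGain (t : ℝ) : ℝ :=
  t / (3 * (t * Real.pi + 1) * Real.sqrt (2 * t * Real.pi + 1))
    + (2 / (3 * Real.pi)) * Real.arctan (t * Real.pi / Real.sqrt (2 * t * Real.pi + 1))

theorem tendsto_sqrt_two_mul_pi_add_one_atTop :
    Tendsto (fun t : ℝ => √(2 * t * π + 1)) atTop atTop := by
  refine tendsto_sqrt_atTop.comp (tendsto_atTop_add_const_right _ _ ?_)
  exact (tendsto_id.const_mul_atTop two_pos).atTop_mul_const pi_pos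

theorem tendsto_arctan_arg_atTop :
    Tendsto (fun t : ℝ => t * π / √(2 * t * π + 1)) atTop atTop := by
  have hs := tendsto_sqrt_two_mul_pi_add_one_atTop
  have h : Tendsto (fun t : ℝ => (√(2 * t * π + 1) + -(√(2 * t * π + 1))⁻¹) / 2)
      atTop atTop :=
    (hs.atTop_add (tendsto_inv_atTop_zero.comp hs).neg).atTop_div_const two_pos
  refine h.congr' ?_
  filter_upwards [eventually_ge_atTop 0] with t ht
  have hpos : 0 < 2 * t * π + 1 := by positivity
  have hne : √(2 * t * π + 1) ≠ 0 := (sqrt_pos.2 hpos).ne'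
  have hsq := sq_sqrt hpos.le
  field_simp
  linarith

theorem tendsto_algebraic_term_zero :
    Tendsto (fun t : ℝ => t / (3 * (t * π + 1) * √(2 * t * π + 1))) atTop (𝓝 0) := by
  refine squeeze_zero' ?_ ?_
    (tendsto_inv_atTop_zero.comp tendsto_sqrt_two_mul_pi_add_one_atTop)
  · filter_upwards [eventually_ge_atTop 0] with t ht
    positivity
  · filter_upwards [eventually_ge_atTop 0] with t ht
    have hle : t / (3 * (t * π + 1)) ≤ 1 := by
      rw [div_le_one (by positivity)]
      nlinarith [mul_nonneg ht (sub_nonneg.2 pi_gt_three.le)]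
    rw [← div_div, div_eq_mul_inv]
    exact mul_le_of_le_one_left (by positivity) hle

theorem tendsto_gGain_atTop : Tendsto gGain atTop (𝓝 (1 / 3)) := by
  have harctan := tendsto_nhds_of_tendsto_nhdsWithin
    (tendsto_arctan_atTop.comp tendsto_arctan_arg_atTop)
  have h := tendsto_algebraic_term_zero.add (harctan.const_mul (2 / (3 * π)))
  have hlim : 0 + 2 / (3 * π) * (π / 2) = 1 / 3 := by
    field_simp
    norm_num
  rw [hlim] at h
  exact h

theorem asymptotic_channel_gain_limit :
    Filter.Tendsto gGain Filter.atTop (nhds (1 / 3)) ∧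
    ∀ d A : ℝ, 0 < d → 0 < A →
      Filter.Tendsto (fun N : ℕ => gGain (N * (A / (4 * Real.pi * d ^ 2))))
        Filter.atTop (nhds (1 / 3)) := by
  refine ⟨tendsto_gGain_atTop, fun d A hd hA => tendsto_gGain_atTop.comp ?_⟩
  exact tendsto_natCast_atTop_atTop.atTop_mul_const (by positivity)
end

section
/- Define g(t) = t / (3(tπ + 1)·√(2tπ + 1)) + (2/(3π))·arctan( tπ / √(2tπ + 1) ). Then 0 < g(t) < 1/3 for every t > 0. -/
open Real

/-- Since `(a + 1)² = a² + (2a + 1)`, the angle `arctan (√(2a + 1) / a)` has sine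
`√(2a + 1) / (a + 1)`, and an angle exceeds its sine. -/
theorem sqrt_div_lt_arctan {a : ℝ} (ha : 0 < a) :
    √(2 * a + 1) / (a + 1) < arctan (√(2 * a + 1) / a) := by
  have hs : 0 < √(2 * a + 1) := Real.sqrt_pos.2 (by positivity)
  have hs2 : √(2 * a + 1) ^ 2 = 2 * a + 1 := Real.sq_sqrt (by positivity)
  have h := Real.sin_lt (Real.arctan_pos.2 (div_pos hs ha))
  have hsq : √(1 + (√(2 * a + 1) / a) ^ 2) = (a + 1) / a := by
    rw [div_pow, hs2, Real.sqrt_eq_iff_mul_self_eq (by positivity) (by positivity)]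
    field_simp
    ring
  rwa [Real.sin_arctan, hsq, div_div_div_cancel_right₀ ha.ne'] at h

theorem div_add_two_mul_arctan_lt_pi {a : ℝ} (ha : 0 < a) :
    a / ((a + 1) * √(2 * a + 1)) + 2 * arctan (a / √(2 * a + 1)) < π := by
  have hs : 0 < √(2 * a + 1) := Real.sqrt_pos.2 (by positivity)
  have hs2 : √(2 * a + 1) ^ 2 = 2 * a + 1 := Real.sq_sqrt (by positivity)
  have hinv := Real.arctan_inv_of_pos (div_pos ha hs)
  rw [inv_div] at hinv
  have hle : a / ((a + 1) * √(2 * a + 1)) ≤ 2 * (√(2 * a + 1) / (a + 1)) := by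
    rw [← mul_div_assoc, div_le_div_iff₀ (by positivity) (by positivity)]
    have : 2 * √(2 * a + 1) * ((a + 1) * √(2 * a + 1)) = 2 * (2 * a + 1) * (a + 1) := by
      linear_combination 2 * (a + 1) * hs2
    rw [this]
    gcongr
    linarith
  linarith [sqrt_div_lt_arctan ha]

theorem channel_gain_strict_bounds (t : ℝ) (ht : 0 < t) :
    0 < gGain t ∧ gGain t < 1 / 3 := by
  have ha : 0 < t * π := mul_pos ht Real.pi_pos
  have hs : 0 < √(2 * (t * π) + 1) := Real.sqrt_pos.2 (by positivity)
  have hg : gGain t = (t * π / ((t * π + 1) * √(2 * (t * π) + 1))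
      + 2 * arctan (t * π / √(2 * (t * π) + 1))) / (3 * π) := by
    rw [gGain, mul_assoc 2 t π]
    field_simp
  have harctan : 0 < arctan (t * π / √(2 * (t * π) + 1)) := Real.arctan_pos.2 (div_pos ha hs)
  rw [hg]
  refine ⟨by positivity, ?_⟩
  rw [div_lt_iff₀ (by positivity)]
  linarith [div_add_two_mul_arctan_lt_pi ha]
end

section
/- Let d > 0, A > 0, N ≥ 1, and φ ∈ (−π/2, π/2), and set B = NA/(4d²cos²(φ)). Define ζ as the closed form (1/(4π)) Σ_{x ∈ X} Σ_{y ∈ Y} [ (xy/d²) / (3(y²/d² + 1)·√(x²/d² + y²/d² + 1)) + (2/3)·arctan( (xy/d²) / √(x²/d² + y²/d² + 1) ) ] evaluated with transmitter coordinates x_t = d·sin(φ), y_t = 0, vertical distance d·cos(φ) in place of d, receiver center x_n = y_n = 0, and side a = √(NA), i.e., with pairs X = (√(NA)/2 − d sin(φ), √(NA)/2 + d sin(φ)) and Y = (√(NA)/2, √(NA)/2). Then ζ = Ξ(B, φ), where Ξ(B, φ) := Σ_{i=1}^{2} [ (B + (−1)^i √B·tan(φ)) / (6π(B + 1)·√(2B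 + tan²(φ) + 1 + 2(−1)^i √B·tan(φ))) + (1/(3π))·arctan( (B + (−1)^i √B·tan(φ)) / √(2B + tan²(φ) + 1 + 2(−1)^i √B·tan(φ)) ) ]. -/
open Real

/-- One of the two terms (`s = (−1)^i`) in the channel-gain formula `Ξ(B, φ)`. -/
noncomputable def XiTerm (B φ s : ℝ) : ℝ :=
  (B + s * Real.sqrt B * Real.tan φ) /
      (6 * Real.pi * (B + 1) *
        Real.sqrt (2 * B + Real.tan φ ^ 2 + 1 + 2 * s * Real.sqrt B * Real.tan φ))
    + (1 / (3 * Real.pi)) *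
      Real.arctan ((B + s * Real.sqrt B * Real.tan φ) /
        Real.sqrt (2 * B + Real.tan φ ^ 2 + 1 + 2 * s * Real.sqrt B * Real.tan φ))

/-- The total channel gain `Ξ(B, φ)` of a planar square array serving a transmitter at
azimuth angle `φ`, where `B = NA/(4d²cos²φ)`. -/
noncomputable def Xi (B φ : ℝ) : ℝ := XiTerm B φ (-1) + XiTerm B φ 1

/-- After rescaling by the vertical distance, each term of `ζ` is a multiple of a term of `Ξ`. -/
theorem zetaTerm_mul_eq_XiTerm {D B φ s : ℝ} (hD : D ≠ 0) (hB : 0 ≤ B) (hs : s ^ 2 = 1) :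
    zetaTerm D (D * (√B + s * tan φ)) (D * √B) = 2 * π * XiTerm B φ s := by
  have hr : √B ^ 2 = B := Real.sq_sqrt hB
  have hxy : D * (√B + s * tan φ) * (D * √B) / D ^ 2 = B + s * √B * tan φ := by
    field_simp
    linear_combination hr
  have hy : (D * √B) ^ 2 / D ^ 2 = B := by
    rw [mul_pow, hr]
    field_simp
  have hx : (D * (√B + s * tan φ)) ^ 2 / D ^ 2 =
      B + tan φ ^ 2 + 2 * s * √B * tan φ := by
    field_simp
    linear_combination hr + tan φ ^ 2 * hs
  have hsum : B + tan φ ^ 2 + 2 * s * √B * tan φ + B + 1 =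
      2 * B + tan φ ^ 2 + 1 + 2 * s * √B * tan φ := by ring
  have hfrac (u v w : ℝ) : u / (3 * v * w) = 2 * π * (u / (6 * π * v * w)) := by
    rw [show 6 * π * v * w = 2 * π * (3 * v * w) by ring, ← mul_div_assoc,
      mul_div_mul_left _ _ (by positivity)]
  unfold zetaTerm XiTerm
  rw [hxy, hx, hy, hsum, hfrac]
  field_simp

theorem angled_transmitter_channel_gain
    (d A : ℝ) (N : ℕ) (φ : ℝ) (hd : 0 < d) (hA : 0 < A) (hN : 1 ≤ N)
    (hφ : φ ∈ Set.Ioo (-(Real.pi / 2)) (Real.pi / 2))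
    (B : ℝ) (hB : B = N * A / (4 * d ^ 2 * Real.cos φ ^ 2)) :
    zetaClosed (d * Real.cos φ) (Real.sqrt (N * A)) (d * Real.sin φ) 0 0 0 = Xi B φ := by
  have hc : 0 < cos φ := cos_pos_of_mem_Ioo hφ
  have hD : 0 < d * cos φ := by positivity
  have hB0 : 0 ≤ B := by rw [hB]; positivity
  have hside : √(N * A) = 2 * (d * cos φ * √B) := by
    rw [show (N : ℝ) * A = (2 * (d * cos φ)) ^ 2 * B by rw [hB]; field_simp; ring,
      Real.sqrt_mul (by positivity), Real.sqrt_sq (by positivity)]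
    ring
  have hoff : d * sin φ = d * cos φ * tan φ := by
    rw [mul_assoc, mul_comm (cos φ), tan_mul_cos hc.ne']
  have hy₁ : √(N * A) / 2 + 0 - 0 = d * cos φ * √B := by rw [hside]; ring
  have hy₂ : √(N * A) / 2 - 0 + 0 = d * cos φ * √B := by rw [hside]; ring
  have hx₁ : √(N * A) / 2 + 0 - d * sin φ = d * cos φ * (√B + -1 * tan φ) := by
    rw [hside, hoff]; ring
  have hx₂ : √(N * A) / 2 - 0 + d * sin φ = d * cos φ * (√B + 1 * tan φ) := by
    rw [hside, hoff]; ring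
  unfold zetaClosed Xi
  rw [hy₁, hy₂, hx₁, hx₂, zetaTerm_mul_eq_XiTerm hD.ne' hB0 (by norm_num),
    zetaTerm_mul_eq_XiTerm hD.ne' hB0 (by norm_num)]
  field_simp
  ring
end

section
/- Fix φ ∈ (−π/2, π/2). Then Ξ(B, φ) / ((B/π)·cos³(φ)) → 1 as B → 0⁺. Equivalently, for fixed N, A, φ, the total channel gain Ξ(NA/(4d²cos²(φ)), φ) is asymptotically equal to N·β_{d cos(φ)}·cos³(φ) as d → ∞, where β_{d cos(φ)} = A/(4π d² cos²(φ)). -/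
open Real Filter Topology

/-- The first central difference quotient at `0` tends to twice the derivative. -/
lemma HasDerivAt.tendsto_central_difference {f : ℝ → ℝ} {f' : ℝ} (hf : HasDerivAt f f' 0) :
    Tendsto (fun x => (f x - f (-x)) / x) (𝓝[>] 0) (𝓝 (2 * f')) := by
  have hneg : HasDerivAt (fun x => f (-x)) (-f') 0 := by
    have h : HasDerivAt f f' (-0) := by simpa using hf
    simpa [Function.comp_def] using h.scomp (0 : ℝ) (hasDerivAt_neg (0 : ℝ))
  have h := (hf.sub hneg).tendsto_slope.mono_left
    (nhdsWithin_mono (0 : ℝ) fun x (hx : x ∈ Set.Ioi 0) => ne_of_gt hx)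
  rw [sub_neg_eq_add, ← two_mul] at h
  refine h.congr fun x => ?_
  simp [slope_def_field]

/-- A strictly differentiable function with derivative `1` at `0` does not change the leading order
of the difference of two quantities tending to `0`. -/
lemma HasStrictDerivAt.tendsto_sub_div {α : Type*} {l : Filter α} {g : ℝ → ℝ}
    (hg : HasStrictDerivAt g 1 0) {a b r : α → ℝ} {L : ℝ}
    (ha : Tendsto a l (𝓝 0)) (hb : Tendsto b l (𝓝 0)) (hr : ∀ᶠ x in l, r x ≠ 0)
    (hab : Tendsto (fun x => (a x - b x) / r x) l (𝓝 L)) :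
    Tendsto (fun x => (g (a x) - g (b x)) / r x) l (𝓝 L) := by
  have ho : (fun x => g (a x) - g (b x) - (a x - b x)) =o[l] fun x => a x - b x := by
    have h := (hg.hasStrictFDerivAt.isLittleO).comp_tendsto (ha.prodMk_nhds hb)
    simpa [Function.comp_def] using h
  have hO : (fun x => a x - b x) =O[l] r :=
    Asymptotics.isBigO_of_div_tendsto_nhds (hr.mono fun x hx h => absurd h hx) L hab
  simpa [← add_div] using (ho.trans_isBigO hO).tendsto_div_nhds_zero.add hab

/-- The argument of the arctangent in `XiTerm`, divided by `x = s * √B`, with `t = tan φ`. -/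
noncomputable def arctanSlope (t x : ℝ) : ℝ :=
  (x + t) / √(2 * x ^ 2 + t ^ 2 + 1 + 2 * x * t)

lemma hasDerivAt_arctanSlope_zero (t : ℝ) :
    HasDerivAt (arctanSlope t) ((√(1 + t ^ 2))⁻¹ ^ 3) 0 := by
  have hpos : 0 < 1 + t ^ 2 := by positivity
  have hrad : HasDerivAt (fun x : ℝ => 2 * x ^ 2 + t ^ 2 + 1 + 2 * x * t) (2 * t) 0 := by
    have h := (((((hasDerivAt_id (0 : ℝ)).pow 2).const_mul 2).add_const (t ^ 2)).add_const 1).add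
      (((hasDerivAt_id (0 : ℝ)).const_mul 2).mul_const t)
    exact h.congr_deriv (by simp)
  have hne : 2 * (0 : ℝ) ^ 2 + t ^ 2 + 1 + 2 * 0 * t = 1 + t ^ 2 := by ring
  have h := ((hasDerivAt_id (0 : ℝ)).add_const t).div
    (hrad.sqrt (by rw [hne]; exact hpos.ne')) (by rw [hne]; positivity)
  refine h.congr_deriv ?_
  simp only [hne, id]
  have hs : √(1 + t ^ 2) ^ 2 = 1 + t ^ 2 := Real.sq_sqrt hpos.le
  have hs0 : √(1 + t ^ 2) ≠ 0 := by positivity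
  field_simp
  rw [hs]
  ring

lemma Xi_sq {x : ℝ} (hx : 0 < x) (φ : ℝ) :
    Xi (x ^ 2) φ =
      x * (arctanSlope (tan φ) x - arctanSlope (tan φ) (-x)) / (6 * π * (x ^ 2 + 1)) +
      1 / (3 * π) * (arctan (x * arctanSlope (tan φ) x) -
        arctan (x * arctanSlope (tan φ) (-x))) := by
  have hrw : ∀ s : ℝ, s ^ 2 = 1 → XiTerm (x ^ 2) φ s =
      s * x * arctanSlope (tan φ) (s * x) / (6 * π * (x ^ 2 + 1)) +
      1 / (3 * π) * arctan (s * x * arctanSlope (tan φ) (s * x)) := by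
    intro s hs
    have hnum : x ^ 2 + s * x * tan φ = s * x * (s * x + tan φ) := by
      linear_combination -x ^ 2 * hs
    have hrad : 2 * x ^ 2 + tan φ ^ 2 + 1 + 2 * s * x * tan φ =
        2 * (s * x) ^ 2 + tan φ ^ 2 + 1 + 2 * (s * x) * tan φ := by
      linear_combination -2 * x ^ 2 * hs
    rw [XiTerm, Real.sqrt_sq hx.le, hnum, hrad, arctanSlope, mul_div_assoc (s * x),
      mul_div_assoc (s * x), mul_div_assoc (s * x), div_div, mul_comm (√_)]
  rw [Xi, hrw (-1) (by norm_num), hrw 1 (by norm_num)]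
  simp only [neg_mul, one_mul, arctan_neg]
  ring

lemma tendsto_Xi_sq_div_sq {φ : ℝ} (hφ : 0 < cos φ) :
    Tendsto (fun x => Xi (x ^ 2) φ / x ^ 2) (𝓝[>] 0) (𝓝 (cos φ ^ 3 / π)) := by
  set v := arctanSlope (tan φ) with hv
  have hderiv : HasDerivAt v (cos φ ^ 3) 0 := by
    have h := hasDerivAt_arctanSlope_zero (tan φ)
    rwa [inv_sqrt_one_add_tan_sq hφ] at h
  have hquot := hderiv.tendsto_central_difference
  have hid : Tendsto (fun x : ℝ => x) (𝓝[>] 0) (𝓝 0) :=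
    tendsto_nhdsWithin_of_tendsto_nhds tendsto_id
  have hcont : Tendsto v (𝓝 0) (𝓝 (v 0)) := hderiv.continuousAt
  have ha : Tendsto (fun x => x * v x) (𝓝[>] 0) (𝓝 0) := by
    simpa using hid.mul (hcont.comp hid)
  have hb : Tendsto (fun x => x * v (-x)) (𝓝[>] 0) (𝓝 0) := by
    simpa using hid.mul (hcont.comp (by simpa using hid.neg))
  have hpos : ∀ᶠ x : ℝ in 𝓝[>] 0, 0 < x := self_mem_nhdsWithin
  have hab : Tendsto (fun x => (x * v x - x * v (-x)) / x ^ 2) (𝓝[>] 0) (𝓝 (2 * cos φ ^ 3)) := by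
    refine hquot.congr' ?_
    filter_upwards [hpos] with x hx
    field_simp
  have harctan := HasStrictDerivAt.tendsto_sub_div
    (by simpa using hasStrictDerivAt_arctan 0) ha hb
    (hpos.mono fun x hx => pow_ne_zero 2 hx.ne') hab
  have hden : Tendsto (fun x : ℝ => 6 * π * (x ^ 2 + 1)) (𝓝[>] 0) (𝓝 (6 * π)) := by
    simpa using ((hid.pow 2).add_const 1).const_mul (6 * π)
  have h := (hquot.div hden (by positivity)).add (harctan.const_mul (1 / (3 * π)))
  have hlim : 2 * cos φ ^ 3 / (6 * π) + 1 / (3 * π) * (2 * cos φ ^ 3) = cos φ ^ 3 / π := by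
    field_simp
    ring
  rw [hlim] at h
  refine h.congr' ?_
  filter_upwards [hpos] with x hx
  rw [Xi_sq hx, ← hv]
  simp only [Pi.div_apply]
  field_simp

theorem far_field_snr_approximation
    (φ : ℝ) (hφ : φ ∈ Set.Ioo (-(Real.pi / 2)) (Real.pi / 2)) :
    Filter.Tendsto (fun B : ℝ => Xi B φ / ((B / Real.pi) * Real.cos φ ^ 3))
      (nhdsWithin 0 (Set.Ioi 0)) (nhds 1) ∧
    ∀ (A : ℝ) (N : ℕ), 0 < A → 1 ≤ N →
      Filter.Tendsto (fun d : ℝ =>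
          Xi (N * A / (4 * d ^ 2 * Real.cos φ ^ 2)) φ /
            (N * (A / (4 * Real.pi * (d * Real.cos φ) ^ 2)) * Real.cos φ ^ 3))
        Filter.atTop (nhds 1) := by
  have hcos : 0 < cos φ := cos_pos_of_mem_Ioo hφ
  have hmain : Tendsto (fun B : ℝ => Xi B φ / ((B / π) * cos φ ^ 3)) (𝓝[>] 0) (𝓝 1) := by
    have hsqrt : Tendsto (fun B : ℝ => √B) (𝓝[>] 0) (𝓝[>] 0) := by
      refine tendsto_nhdsWithin_iff.mpr ⟨?_, ?_⟩
      · simpa using (continuous_sqrt.tendsto 0).mono_left nhdsWithin_le_nhds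
      · filter_upwards [self_mem_nhdsWithin] with B hB using sqrt_pos.mpr hB
    have h := ((tendsto_Xi_sq_div_sq hcos).comp hsqrt).div_const (cos φ ^ 3 / π)
    rw [div_self (by positivity)] at h
    refine h.congr' ?_
    filter_upwards [self_mem_nhdsWithin] with B (hB : 0 < B)
    simp only [Function.comp_apply, sq_sqrt hB.le]
    field_simp
  refine ⟨hmain, fun A N hA hN => ?_⟩
  have hN' : (0 : ℝ) < N := by exact_mod_cast hN
  have hB : Tendsto (fun d : ℝ => N * A / (4 * d ^ 2 * cos φ ^ 2)) atTop (𝓝[>] 0) := by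
    refine tendsto_nhdsWithin_iff.mpr ⟨?_, ?_⟩
    · refine tendsto_const_nhds.div_atTop ?_
      exact ((tendsto_pow_atTop two_ne_zero).const_mul_atTop (by norm_num)).atTop_mul_const
        (by positivity)
    · filter_upwards [eventually_gt_atTop 0] with d hd
      exact Set.mem_Ioi.mpr (by positivity)
  refine (hmain.comp hB).congr fun d => ?_
  simp only [Function.comp_apply]
  congr 2
  rw [mul_pow]
  ring
end

section
/- Fix φ ∈ (−π/2, π/2). Then Ξ(B, φ) → 1/3 as B → +∞. In particular, for fixed d > 0, A > 0, φ, the matched-filter total channel gain Ξ(NA/(4d²cos²(φ)), φ) converges to 1/3 as N → ∞. -/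
open Real Filter Topology

/-- Two-sided linear bounds, for large `x = √B`, on the distance term of `XiTerm`. -/
theorem sqrt_quadratic_bounds {c t x : ℝ} (hx : 2 * |c| + t ^ 2 + 1 ≤ x) :
    x ≤ √(2 * x ^ 2 + t ^ 2 + 1 + 2 * c * x) ∧ √(2 * x ^ 2 + t ^ 2 + 1 + 2 * c * x) ≤ 2 * x := by
  have hc := abs_le.mp (le_refl |c|)
  have hc0 := abs_nonneg c
  have ht := sq_nonneg t
  have hx1 : 1 ≤ x := by linarith
  refine ⟨Real.le_sqrt_of_sq_le ?_, Real.sqrt_le_iff.mpr ⟨by linarith, ?_⟩⟩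
  · nlinarith [mul_nonneg (by linarith : 0 ≤ x) (by linarith : 0 ≤ x + 2 * c)]
  · nlinarith [mul_nonneg (by linarith : 0 ≤ x) (by linarith : 0 ≤ x - 2 * c - t ^ 2 - 1),
      mul_nonneg (by linarith : 0 ≤ x - 1) (by linarith : 0 ≤ t ^ 2 + 1)]

theorem tendsto_XiTerm_atTop (φ s : ℝ) :
    Tendsto (fun B : ℝ => XiTerm B φ s) atTop (𝓝 (1 / 6)) := by
  set t := Real.tan φ
  have hlarge : ∀ᶠ B : ℝ in atTop, 0 ≤ B ∧ 2 * |s * t| + t ^ 2 + 1 ≤ √B :=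
    (eventually_ge_atTop 0).and (Real.tendsto_sqrt_atTop.eventually_ge_atTop _)
  have hbounds : ∀ᶠ B : ℝ in atTop, 0 ≤ B ∧ 1 ≤ √B ∧
      B / 2 ≤ B + s * √B * t ∧ B + s * √B * t ≤ 2 * B ∧
      √B ≤ √(2 * B + t ^ 2 + 1 + 2 * s * √B * t) ∧
      √(2 * B + t ^ 2 + 1 + 2 * s * √B * t) ≤ 2 * √B := by
    filter_upwards [hlarge] with B ⟨hB, hx⟩
    have hD := sqrt_quadratic_bounds hx
    rw [Real.sq_sqrt hB, show 2 * (s * t) * √B = 2 * s * √B * t by ring] at hD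
    have hc := abs_le.mp (le_refl |s * t|)
    have hsq := Real.mul_self_sqrt hB
    have hx0 := Real.sqrt_nonneg B
    have ht2 := sq_nonneg t
    have hc0 := abs_nonneg (s * t)
    refine ⟨hB, by linarith, ?_, ?_, hD⟩
    · nlinarith [mul_nonneg hx0 (by linarith : 0 ≤ √B + 2 * (s * t))]
    · nlinarith [mul_nonneg hx0 (by linarith : 0 ≤ √B - s * t)]
  have hratio : Tendsto (fun B : ℝ => (B + s * √B * t) / √(2 * B + t ^ 2 + 1 + 2 * s * √B * t))
      atTop atTop := by
    refine tendsto_atTop_mono' atTop ?_ (Real.tendsto_sqrt_atTop.atTop_div_const four_pos)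
    filter_upwards [hbounds] with B ⟨hB, hx, hN, _, hD, hD'⟩
    rw [le_div_iff₀ (by linarith)]
    nlinarith [Real.mul_self_sqrt hB]
  have hfirst : Tendsto (fun B : ℝ => (B + s * √B * t) /
      (6 * π * (B + 1) * √(2 * B + t ^ 2 + 1 + 2 * s * √B * t))) atTop (𝓝 0) := by
    refine squeeze_zero' ?_ ?_ (Real.tendsto_sqrt_atTop.const_div_atTop 2)
    · filter_upwards [hbounds] with B ⟨hB, _, hN, _⟩
      have := Real.pi_pos
      exact div_nonneg (by linarith) (by positivity)
    · filter_upwards [hbounds] with B ⟨hB, hx, _, hN, hD, _⟩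
      have hpi := Real.pi_gt_three
      have hden : B * √B ≤ 6 * π * (B + 1) * √(2 * B + t ^ 2 + 1 + 2 * s * √B * t) :=
        mul_le_mul (by nlinarith) hD (by linarith) (by positivity)
      have hD0 : 0 < √(2 * B + t ^ 2 + 1 + 2 * s * √B * t) := by linarith
      rw [div_le_div_iff₀ (mul_pos (by positivity) hD0) (by linarith)]
      nlinarith
  have harctan := ((tendsto_nhds_of_tendsto_nhdsWithin Real.tendsto_arctan_atTop).comp
    hratio).const_mul (1 / (3 * π))
  have h := hfirst.add harctan
  rw [show 0 + 1 / (3 * π) * (π / 2) = 1 / 6 by field_simp; norm_num] at h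
  exact h

theorem snr_saturation
    (φ : ℝ) (hφ : φ ∈ Set.Ioo (-(Real.pi / 2)) (Real.pi / 2)) :
    Filter.Tendsto (fun B : ℝ => Xi B φ) Filter.atTop (nhds (1 / 3)) ∧
    ∀ d A : ℝ, 0 < d → 0 < A →
      Filter.Tendsto (fun N : ℕ => Xi (N * A / (4 * d ^ 2 * Real.cos φ ^ 2)) φ)
        Filter.atTop (nhds (1 / 3)) := by
  have hlim : Tendsto (fun B : ℝ => Xi B φ) atTop (𝓝 (1 / 3)) := by
    have h := (tendsto_XiTerm_atTop φ (-1)).add (tendsto_XiTerm_atTop φ 1)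
    rw [show (1 / 6 + 1 / 6 : ℝ) = 1 / 3 by norm_num] at h
    exact h
  refine ⟨hlim, fun d A hd hA => hlim.comp ?_⟩
  have hcos := Real.cos_pos_of_mem_Ioo hφ
  exact (tendsto_natCast_atTop_atTop.atTop_mul_const hA).atTop_div_const (by positivity)
end

section
/- Let C(x) = ∫₀ˣ cos(πt²/2) dt and S(x) = ∫₀ˣ sin(πt²/2) dt, and define A(x) = (C(√x)² + S(√x)²)² / x² for x > 0. Then A is decreasing (antitone) on the interval (0, 2]. -/
open Real MeasureTheory

/-- The Fresnel cosine integral `C(x) = ∫₀ˣ cos(πt²/2) dt`. -/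
noncomputable def fresnelC (x : ℝ) : ℝ := ∫ t in (0 : ℝ)..x, Real.cos (Real.pi * t ^ 2 / 2)

/-- The Fresnel sine integral `S(x) = ∫₀ˣ sin(πt²/2) dt`. -/
noncomputable def fresnelS (x : ℝ) : ℝ := ∫ t in (0 : ℝ)..x, Real.sin (Real.pi * t ^ 2 / 2)

/-- The normalized array-gain profile `A(x) = (C(√x)² + S(√x)²)² / x²`. -/
noncomputable def gainProfile (x : ℝ) : ℝ :=
  (fresnelC (Real.sqrt x) ^ 2 + fresnelS (Real.sqrt x) ^ 2) ^ 2 / x ^ 2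

theorem sqrt_mul_integral_comp_sq (f : ℝ → ℝ) {x : ℝ} (hx : 0 ≤ x) :
    √x * ∫ s in (0 : ℝ)..1, f (π * x * s ^ 2 / 2) = ∫ t in (0 : ℝ)..√x, f (π * t ^ 2 / 2) := by
  have h := intervalIntegral.mul_integral_comp_mul_left (a := 0) (b := 1)
    (f := fun t => f (π * t ^ 2 / 2)) (√x)
  simpa [mul_pow, Real.sq_sqrt hx, ← mul_assoc] using h

theorem cos_mul_integral_cos_add_sin_mul_integral_sin {f : ℝ → ℝ} (hf : Continuous f)
    (a : ℝ) :
    cos a * (∫ t in (0 : ℝ)..1, cos (f t)) + sin a * (∫ t in (0 : ℝ)..1, sin (f t)) =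
      ∫ t in (0 : ℝ)..1, cos (a - f t) := by
  simp only [cos_sub]
  rw [intervalIntegral.integral_add (Continuous.intervalIntegrable (by fun_prop) _ _)
    (Continuous.intervalIntegrable (by fun_prop) _ _),
    intervalIntegral.integral_const_mul, intervalIntegral.integral_const_mul]

theorem sq_integral_cos_add_sq_integral_sin {f : ℝ → ℝ} (hf : Continuous f) :
    (∫ t in (0 : ℝ)..1, cos (f t)) ^ 2 + (∫ t in (0 : ℝ)..1, sin (f t)) ^ 2 =
      ∫ s in (0 : ℝ)..1, ∫ t in (0 : ℝ)..1, cos (f s - f t) := by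
  simp only [← cos_mul_integral_cos_add_sin_mul_integral_sin hf]
  rw [intervalIntegral.integral_add (Continuous.intervalIntegrable (by fun_prop) _ _)
    (Continuous.intervalIntegrable (by fun_prop) _ _),
    intervalIntegral.integral_mul_const, intervalIntegral.integral_mul_const]
  ring

theorem cos_mul_le_cos_mul {a x y : ℝ} (hx : 0 ≤ x) (hxy : x ≤ y) (hy : |a| * y ≤ π) :
    cos (a * y) ≤ cos (a * x) := by
  rw [← cos_abs (a * y), ← cos_abs (a * x), abs_mul, abs_mul, abs_of_nonneg hx,
    abs_of_nonneg (hx.trans hxy)]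
  exact cos_le_cos_of_nonneg_of_le_pi (by positivity) hy (by gcongr)

theorem fresnelC_sq_add_fresnelS_sq_sqrt {x : ℝ} (hx : 0 ≤ x) :
    fresnelC √x ^ 2 + fresnelS √x ^ 2 =
      x * ∫ s in (0 : ℝ)..1, ∫ t in (0 : ℝ)..1,
        cos (π * x * s ^ 2 / 2 - π * x * t ^ 2 / 2) := by
  rw [← sq_integral_cos_add_sq_integral_sin (f := fun s => π * x * s ^ 2 / 2) (by fun_prop),
    fresnelC, fresnelS, ← sqrt_mul_integral_comp_sq cos hx, ← sqrt_mul_integral_comp_sq sin hx,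
    mul_pow, mul_pow, Real.sq_sqrt hx]
  ring

theorem gainProfile_eq_sq {x : ℝ} (hx : 0 < x) :
    gainProfile x = (∫ s in (0 : ℝ)..1, ∫ t in (0 : ℝ)..1,
      cos (π * x * s ^ 2 / 2 - π * x * t ^ 2 / 2)) ^ 2 := by
  rw [gainProfile, fresnelC_sq_add_fresnelS_sq_sqrt hx.le, mul_pow,
    mul_div_cancel_left₀ _ (by positivity)]

theorem continuous_integral_cos_sub {f : ℝ → ℝ} (hf : Continuous f) :
    Continuous fun s => ∫ t in (0 : ℝ)..1, cos (f s - f t) := by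
  simp only [← cos_mul_integral_cos_add_sin_mul_integral_sin hf]
  fun_prop

theorem integral_integral_cos_antitone {x y : ℝ} (hx : 0 ≤ x) (hxy : x ≤ y) (hy : y ≤ 2) :
    ∫ s in (0 : ℝ)..1, ∫ t in (0 : ℝ)..1, cos (π * y * s ^ 2 / 2 - π * y * t ^ 2 / 2) ≤
      ∫ s in (0 : ℝ)..1, ∫ t in (0 : ℝ)..1, cos (π * x * s ^ 2 / 2 - π * x * t ^ 2 / 2) := by
  have hcont (z : ℝ) := continuous_integral_cos_sub (f := fun s => π * z * s ^ 2 / 2)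
    (by fun_prop)
  refine intervalIntegral.integral_mono_on zero_le_one ((hcont y).intervalIntegrable _ _)
    ((hcont x).intervalIntegrable _ _) fun s hs => ?_
  refine intervalIntegral.integral_mono_on zero_le_one
    (Continuous.intervalIntegrable (by fun_prop) _ _)
    (Continuous.intervalIntegrable (by fun_prop) _ _) fun t ht => ?_
  have hfactor (z : ℝ) :
      π * z * s ^ 2 / 2 - π * z * t ^ 2 / 2 = π / 2 * (s ^ 2 - t ^ 2) * z := by ring
  rw [hfactor, hfactor]
  refine cos_mul_le_cos_mul hx hxy ?_
  have hst : |s ^ 2 - t ^ 2| ≤ 1 := by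
    rw [abs_le]
    constructor <;> nlinarith [hs.1, hs.2, ht.1, ht.2]
  rw [abs_mul, abs_of_pos (by positivity : 0 < π / 2)]
  calc π / 2 * |s ^ 2 - t ^ 2| * y ≤ π / 2 * 1 * 2 := by
        have := hx.trans hxy
        gcongr
    _ = π := by ring

theorem gainProfile_antitoneOn : AntitoneOn gainProfile (Set.Ioc 0 2) := by
  intro x hx y hy hxy
  rw [gainProfile_eq_sq hx.1, gainProfile_eq_sq hy.1]
  refine pow_le_pow_left₀ ?_ (integral_integral_cos_antitone hx.1.le hxy hy.2) 2
  rw [← sq_integral_cos_add_sq_integral_sin (f := fun s => π * y * s ^ 2 / 2) (by fun_prop)]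
  positivity
end

section
/- Let F > 0 and z > 0. If z < F/10, then the set {d > 0 : F·|d − z|/(8dz) ≤ 5/4} equals the closed interval [Fz/(F + 10z), Fz/(F − 10z)]. If z ≥ F/10, then the set {d > 0 : F·|d − z|/(8dz) ≤ 5/4} equals [Fz/(F + 10z), ∞). -/
open Real Set

/-- For a positive distance, the half-power condition is a pair of linear inequalities. -/
theorem half_power_condition_iff {F z d : ℝ} (hF : 0 < F) (hz : 0 < z) (hd : 0 < d) :
    F * |d - z| / (8 * d * z) ≤ 5 / 4 ↔
      F * z ≤ d * (F + 10 * z) ∧ d * (F - 10 * z) ≤ F * z := by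
  rw [div_le_iff₀ (by positivity), ← abs_of_pos hF, ← abs_mul, abs_of_pos hF, abs_le]
  constructor <;> rintro ⟨h₁, h₂⟩ <;> constructor <;> linarith

theorem depth_of_focus_interval (F z : ℝ) (hF : 0 < F) (hz : 0 < z) :
    (z < F / 10 →
      {d : ℝ | 0 < d ∧ F * |d - z| / (8 * d * z) ≤ 5 / 4}
        = Set.Icc (F * z / (F + 10 * z)) (F * z / (F - 10 * z))) ∧
    (F / 10 ≤ z →
      {d : ℝ | 0 < d ∧ F * |d - z| / (8 * d * z) ≤ 5 / 4}
        = Set.Ici (F * z / (F + 10 * z))) := by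
  have hlow {d : ℝ} : F * z / (F + 10 * z) ≤ d ↔ F * z ≤ d * (F + 10 * z) :=
    div_le_iff₀ (by positivity)
  have hpos {d : ℝ} (h : F * z / (F + 10 * z) ≤ d) : 0 < d :=
    lt_of_lt_of_le (by positivity) h
  constructor
  · intro hzF
    ext d
    rw [mem_ofPred_eq, mem_Icc, le_div_iff₀ (by linarith : 0 < F - 10 * z)]
    constructor
    · rintro ⟨hd, h⟩
      rwa [half_power_condition_iff hF hz hd, ← hlow] at h
    · intro h
      refine ⟨hpos h.1, ?_⟩
      rwa [half_power_condition_iff hF hz (hpos h.1), ← hlow]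
  · intro hzF
    ext d
    rw [mem_ofPred_eq, mem_Ici]
    constructor
    · rintro ⟨hd, h⟩
      exact hlow.2 ((half_power_condition_iff hF hz hd).1 h).1
    · intro h
      have hd := hpos h
      refine ⟨hd, (half_power_condition_iff hF hz hd).2 ⟨hlow.1 h, ?_⟩⟩
      exact (mul_nonpos_of_nonneg_of_nonpos hd.le (by linarith)).trans (by positivity)
end

section
/- Let d > 0 and W > 0. Then ∫∫_{x² + y² ≤ (W/2)²} 1/(d² + x² + y²) dx dy ≥ (πW²/(4d²))·(1 − W²/(8d²)). In particular, for d = 2W the ratio of the spherical-wavefront received power ∫∫_{x² + y² ≤ (W/2)²} 1/(d² + x² + y²) dx dy to the planar-wavefront received power πW²/(4d²) is at least 31/32. -/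
open Real MeasureTheory

/-- The integral of a radial function over a closed disc, in polar coordinates. -/
theorem setIntegral_disc_radial (g : ℝ → ℝ) {R : ℝ} (hR : 0 ≤ R) :
    ∫ p in {p : ℝ × ℝ | p.1 ^ 2 + p.2 ^ 2 ≤ R ^ 2}, g (p.1 ^ 2 + p.2 ^ 2)
      = 2 * π * ∫ r in (0 : ℝ)..R, r * g (r ^ 2) := by
  have hmeas : MeasurableSet {p : ℝ × ℝ | p.1 ^ 2 + p.2 ^ 2 ≤ R ^ 2} :=
    measurableSet_le (by fun_prop) (by fun_prop)
  have hpolar : ∀ p ∈ polarCoord.target,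
      p.1 • Set.indicator {p : ℝ × ℝ | p.1 ^ 2 + p.2 ^ 2 ≤ R ^ 2}
          (fun p => g (p.1 ^ 2 + p.2 ^ 2)) (polarCoord.symm p)
        = (Set.Iic R).indicator (fun r => r * g (r ^ 2)) p.1 * (fun _ : ℝ => (1 : ℝ)) p.2 := by
    rintro ⟨r, θ⟩ hp
    rw [polarCoord_target] at hp
    have hr : 0 < r := hp.1
    have hnorm : (r * cos θ) ^ 2 + (r * sin θ) ^ 2 = r ^ 2 := by
      rw [mul_pow, mul_pow, ← mul_add, cos_sq_add_sin_sq, mul_one]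
    simp only [polarCoord_symm_apply, Set.indicator, Set.mem_ofPred_eq, hnorm, Set.mem_Iic,
      sq_le_sq₀ hr.le hR, smul_eq_mul, mul_one, mul_ite, mul_zero]
  rw [← integral_indicator hmeas, ← integral_comp_polarCoord_symm,
    setIntegral_congr_fun polarCoord.open_target.measurableSet hpolar, polarCoord_target,
    Measure.volume_eq_prod,
    setIntegral_prod_mul ((Set.Iic R).indicator fun r => r * g (r ^ 2)) (fun _ : ℝ => (1 : ℝ)),
    setIntegral_indicator measurableSet_Iic, Set.Ioi_inter_Iic,
    intervalIntegral.integral_of_le hR, setIntegral_const, measureReal_def, Real.volume_Ioo,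
    ENNReal.toReal_ofReal (by linarith [pi_pos])]
  simp only [smul_eq_mul]
  ring

theorem isCompact_disc (R : ℝ) : IsCompact {p : ℝ × ℝ | p.1 ^ 2 + p.2 ^ 2 ≤ R ^ 2} := by
  refine (isCompact_Icc (a := ((-|R|, -|R|) : ℝ × ℝ)) (b := (|R|, |R|))).of_isClosed_subset
    (isClosed_le (by fun_prop) (by fun_prop)) ?_
  rintro ⟨x, y⟩ h
  rw [Set.mem_ofPred_eq] at h
  have hx := abs_le.1 (sq_le_sq.1 (by nlinarith [sq_nonneg y] : x ^ 2 ≤ R ^ 2))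
  have hy := abs_le.1 (sq_le_sq.1 (by nlinarith [sq_nonneg x] : y ^ 2 ≤ R ^ 2))
  exact ⟨⟨hx.1, hy.1⟩, ⟨hx.2, hy.2⟩⟩

theorem tangent_le_one_div_add {a s : ℝ} (ha : 0 < a) (hs : 0 ≤ s) :
    1 / a - s / a ^ 2 ≤ 1 / (a + s) := by
  have h : 1 / (a + s) - (1 / a - s / a ^ 2) = s ^ 2 / (a ^ 2 * (a + s)) := by
    field_simp
    ring
  have : 0 ≤ s ^ 2 / (a ^ 2 * (a + s)) := by positivity
  linarith

theorem planar_power_mul_le_spherical_power {d W : ℝ} (hd : 0 < d) (hW : 0 < W) :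
    (π * W ^ 2 / (4 * d ^ 2)) * (1 - W ^ 2 / (8 * d ^ 2))
      ≤ ∫ p in {p : ℝ × ℝ | p.1 ^ 2 + p.2 ^ 2 ≤ (W / 2) ^ 2},
          1 / (d ^ 2 + p.1 ^ 2 + p.2 ^ 2) := by
  have hlin : ∫ r in (0 : ℝ)..(W / 2), r * (1 / d ^ 2 - r ^ 2 / (d ^ 2) ^ 2)
      = (W / 2) ^ 2 / (2 * d ^ 2) - (W / 2) ^ 4 / (4 * d ^ 4) := by
    have hderiv : ∀ r ∈ Set.uIcc 0 (W / 2),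
        HasDerivAt (fun r : ℝ => r ^ 2 / (2 * d ^ 2) - r ^ 4 / (4 * d ^ 4))
          (r * (1 / d ^ 2 - r ^ 2 / (d ^ 2) ^ 2)) r := by
      intro r _
      refine (((hasDerivAt_pow 2 r).div_const (2 * d ^ 2)).sub
        ((hasDerivAt_pow 4 r).div_const (4 * d ^ 4))).congr_deriv ?_
      push_cast
      field_simp
    rw [intervalIntegral.integral_eq_sub_of_hasDerivAt hderiv
      (Continuous.intervalIntegrable (by fun_prop) _ _)]
    simp
  calc (π * W ^ 2 / (4 * d ^ 2)) * (1 - W ^ 2 / (8 * d ^ 2))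
      = ∫ p in {p : ℝ × ℝ | p.1 ^ 2 + p.2 ^ 2 ≤ (W / 2) ^ 2},
          (1 / d ^ 2 - (p.1 ^ 2 + p.2 ^ 2) / (d ^ 2) ^ 2) := by
        rw [setIntegral_disc_radial (fun s => 1 / d ^ 2 - s / (d ^ 2) ^ 2) (by positivity), hlin]
        field_simp
        ring
    _ ≤ _ := by
        refine setIntegral_mono_on ?_ ?_ (isCompact_disc _).measurableSet fun p _ => ?_
        · exact ContinuousOn.integrableOn_compact (isCompact_disc _)
            (Continuous.continuousOn (by fun_prop))
        · refine ContinuousOn.integrableOn_compact (isCompact_disc _)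
            (Continuous.continuousOn ?_)
          exact continuous_const.div (by fun_prop) fun p => by positivity
        · rw [add_assoc]
          exact tangent_le_one_div_add (by positivity) (by positivity)

theorem bjornson_distance_power_loss (d W : ℝ) (hd : 0 < d) (hW : 0 < W) :
    (Real.pi * W ^ 2 / (4 * d ^ 2)) * (1 - W ^ 2 / (8 * d ^ 2))
      ≤ (∫ p in {p : ℝ × ℝ | p.1 ^ 2 + p.2 ^ 2 ≤ (W / 2) ^ 2},
          1 / (d ^ 2 + p.1 ^ 2 + p.2 ^ 2)) ∧
    (d = 2 * W →
      31 / 32 ≤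
        (∫ p in {p : ℝ × ℝ | p.1 ^ 2 + p.2 ^ 2 ≤ (W / 2) ^ 2},
            1 / (d ^ 2 + p.1 ^ 2 + p.2 ^ 2)) /
          (Real.pi * W ^ 2 / (4 * d ^ 2))) := by
  refine ⟨planar_power_mul_le_spherical_power hd hW, fun hdW => ?_⟩
  have hloss : 1 - W ^ 2 / (8 * d ^ 2) = 31 / 32 := by
    rw [hdW]
    field_simp
    norm_num
  rw [le_div_iff₀ (by positivity), mul_comm, ← hloss]
  exact planar_power_mul_le_spherical_power hd hW
end
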